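/- arXiv:0801.3958 — 3 statements merged into one kernel-verified Lean document; each statement's English description precedes it below -/
import Mathlib

section
/- Let H be a group and let i, h, x ∈ H satisfy i² = 1, i x i⁻¹ = x⁻¹, i h i⁻¹ = h⁻¹, and suppose i commutes with h⁻¹ x h. Then h⁻² x h² = x⁻¹; that is, x is conjugate in H to its own inverse (by h²). -/
/-- If the involution `i` inverts both `x` and `h`, and `i` commutes with the
conjugate `h⁻¹ * x * h`, then `h ^ 2` conjugates `x` to its inverse. -/
theorem conj_sq_inverts
    {H : Type*} [Group H] (i h x : H)
    (hi : i ^ 2 = 1)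
    (hix : i * x * i⁻¹ = x⁻¹) (hih : i * h * i⁻¹ = h⁻¹)
    (hcomm : Commute i (h⁻¹ * x * h)) :
    (h ^ 2)⁻¹ * x * h ^ 2 = x⁻¹ := by
  have conj_eq : h⁻¹ * x * h = h * x⁻¹ * h⁻¹ := calc
    h⁻¹ * x * h = i * (h⁻¹ * x * h) * i⁻¹ := by rw [hcomm.eq, mul_inv_cancel_right]
    _ = (i * h * i⁻¹)⁻¹ * (i * x * i⁻¹) * (i * h * i⁻¹) := by group
    _ = h * x⁻¹ * h⁻¹ := by rw [hih, hix, inv_inv]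
  calc
    (h ^ 2)⁻¹ * x * h ^ 2 = h⁻¹ * (h⁻¹ * x * h) * h := by
      simp only [pow_two, mul_inv_rev, mul_assoc]
    _ = h⁻¹ * (h * x⁻¹ * h⁻¹) * h := by rw [conj_eq]
    _ = x⁻¹ := by group
end

section
/- Let G be a finite group, H a normal subgroup of G of odd order, and i ∈ G an involution with G = H ∪ iH (so H has index 2 in G). If x ∈ H commutes with i and there exists an involution t ∈ G with t x t⁻¹ = x⁻¹, then x = 1. -/
/-- In a group, an element of odd order that is conjugated to its inverse by an element of odd
order is trivial. -/
theorem eq_one_of_semiconjBy_inv_of_odd {G : Type*} [Group G] {g x : G}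
    (hg : Odd (orderOf g)) (hx : Odd (orderOf x)) (h : SemiconjBy g x x⁻¹) : x = 1 := by
  have hsq : Commute (g ^ 2) x := by
    simpa only [sq, inv_inv, Commute] using h.inv_right.mul_left h
  obtain ⟨k, hk⟩ := hg
  have hgk : (g ^ 2) ^ (k + 1) = g := by
    rw [← pow_mul, show 2 * (k + 1) = orderOf g + 1 by omega, pow_succ, pow_orderOf_eq_one,
      one_mul]
  have hcomm : Commute g x := hgk ▸ hsq.pow_left (k + 1)
  have hinv : x = x⁻¹ := mul_right_cancel (hcomm.eq.symm.trans h.eq)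
  have hx2 : x ^ 2 = 1 := by rw [sq, mul_eq_one_iff_eq_inv, ← hinv]
  exact orderOf_eq_one_iff.mp
    (Nat.eq_one_of_dvd_coprimes hx.coprime_two_right dvd_rfl (orderOf_dvd_of_pow_eq_one hx2))


/-- Let `G` be a finite group, `H` a normal subgroup of odd order, and `i` an
involution with `G = H ∪ iH`.  If `x ∈ H` commutes with `i` and some involution
`t ∈ G` inverts `x`, then `x = 1`. -/
theorem no_centralized_element_inverted
    {G : Type*} [Group G] [Finite G] (H : Subgroup G) [H.Normal]
    (hodd : Odd (Nat.card H))
    (i : G) (hi1 : i ≠ 1) (hi2 : i ^ 2 = 1)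
    (hcover : ∀ g : G, g ∈ H ∨ ∃ h ∈ H, g = i * h)
    (x : G) (hxH : x ∈ H) (hxi : Commute x i)
    (t : G) (ht1 : t ≠ 1) (ht2 : t ^ 2 = 1)
    (htx : t * x * t⁻¹ = x⁻¹) :
    x = 1 := by
  have odd_orderOf : ∀ g ∈ H, Odd (orderOf g) := fun g hg =>
    hodd.of_dvd_nat (H.orderOf_dvd_natCard hg)
  have ht : SemiconjBy t x x⁻¹ := mul_inv_eq_iff_eq_mul.mp htx
  rcases hcover t with htH | ⟨h, hH, rfl⟩
  · exact eq_one_of_semiconjBy_inv_of_odd (odd_orderOf t htH) (odd_orderOf x hxH) ht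
  · have hi : SemiconjBy i⁻¹ x⁻¹ x⁻¹ := hxi.symm.inv_inv
    have hh := hi.mul_left ht
    rw [inv_mul_cancel_left] at hh
    exact eq_one_of_semiconjBy_inv_of_odd (odd_orderOf h hH) (odd_orderOf x hxH) hh
end

section
/- Let k be a field, n a natural number, and B a subgroup of GL_n(k) such that every element of B is semisimple (i.e., acts as a semisimple endomorphism of kⁿ) and such that for all a, b ∈ B the commutator a b a⁻¹ b⁻¹ is unipotent (i.e., a b a⁻¹ b⁻¹ − 1 is a nilpotent matrix). Then B is abelian. -/
/-- A matrix that is both semisimple and unipotent is the identity. -/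
theorem Matrix.eq_one_of_isSemisimple_of_isNilpotent_sub_one {k ι : Type*} [Field k] [Fintype ι]
    [DecidableEq ι] {A : Matrix ι ι k} (hs : Module.End.IsSemisimple (Matrix.toLin' A))
    (hn : IsNilpotent (A - 1)) : A = 1 := by
  have hs' : Module.End.IsSemisimple (Matrix.toLin' (A - 1)) := by
    have h := hs.aeval (Polynomial.X - 1)
    rw [map_sub, Polynomial.aeval_X, map_one] at h
    rwa [map_sub, Matrix.toLin'_one, ← Module.End.one_eq_id]
  have hn' : IsNilpotent (Matrix.toLin' (A - 1)) := hn.map Matrix.toLinAlgEquiv'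
  have h := Module.End.eq_zero_of_isNilpotent_isSemisimple hn' hs'
  exact sub_eq_zero.mp (Matrix.toLin'.map_eq_zero_iff.mp h)

/-- A subgroup of `GL_n(k)` consisting of semisimple elements whose commutators
are all unipotent is abelian. -/
theorem abelian_of_semisimple_with_unipotent_commutators
    {k : Type*} [Field k] {n : ℕ} (B : Subgroup (GL (Fin n) k))
    (hss : ∀ g ∈ B, Module.End.IsSemisimple (Matrix.toLin' (g : Matrix (Fin n) (Fin n) k)))
    (hcomm : ∀ a ∈ B, ∀ b ∈ B,
      IsNilpotent (((a * b * a⁻¹ * b⁻¹ : GL (Fin n) k) : Matrix (Fin n) (Fin n) k) - 1)) :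
    ∀ a ∈ B, ∀ b ∈ B, a * b = b * a := by
  intro a ha b hb
  have hmem : a * b * a⁻¹ * b⁻¹ ∈ B :=
    B.mul_mem (B.mul_mem (B.mul_mem ha hb) (B.inv_mem ha)) (B.inv_mem hb)
  have h : a * b * a⁻¹ * b⁻¹ = 1 := Units.ext <|
    Matrix.eq_one_of_isSemisimple_of_isNilpotent_sub_one (hss _ hmem) (hcomm a ha b hb)
  rwa [mul_inv_eq_one, mul_inv_eq_iff_eq_mul] at h
end
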